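/- For every n ≥ 1 there do not exist vectors β_1, …, β_6 ∈ ℝ^n, each of the form ±e_i ± e_j for some 1 ≤ i < j ≤ n, whose Gram matrix (⟪β_r, β_s⟫)_{1 ≤ r, s ≤ 6} equals the partial Cartan matrix of the Carter diagram E_6(a_1), namely the matrix with rows (2,0,0,−1,0,0), (0,2,0,−1,1,0), (0,0,2,−1,−1,−1), (−1,−1,−1,2,0,0), (0,1,−1,0,2,0), (0,0,−1,0,0,2). In other words, no root subset of D_n realizes the Carter diagram E_6(a_1). -/

import Mathlib

open RealInnerProductSpace

/-- A root of the root system `D_n` inside `ℝ^n`: a vector of the form `±e_i ± e_j`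
with `i < j`. -/
def IsRootDn (n : ℕ) (x : EuclideanSpace ℝ (Fin n)) : Prop :=
  ∃ i j : Fin n, i < j ∧
    (x = EuclideanSpace.single i (1 : ℝ) + EuclideanSpace.single j (1 : ℝ) ∨
     x = EuclideanSpace.single i (1 : ℝ) - EuclideanSpace.single j (1 : ℝ) ∨
     x = -EuclideanSpace.single i (1 : ℝ) + EuclideanSpace.single j (1 : ℝ) ∨
     x = -EuclideanSpace.single i (1 : ℝ) - EuclideanSpace.single j (1 : ℝ))

/-- The partial Cartan matrix of the Carter diagram `E₆(a₁)`. -/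
def partialCartanE6a1 : Matrix (Fin 6) (Fin 6) ℝ :=
  !![ 2,  0,  0, -1,  0,  0;
      0,  2,  0, -1,  1,  0;
      0,  0,  2, -1, -1, -1;
     -1, -1, -1,  2,  0,  0;
      0,  1, -1,  0,  2,  0;
      0,  0, -1,  0,  0,  2]

namespace IsRootDn

variable {n : ℕ} {w x y z : EuclideanSpace ℝ (Fin n)}

/-- A root of `D_n` is a sum of two signed distinct basis vectors. -/
lemma exists_eq_single_add_single (hx : IsRootDn n x) :
    ∃ (a b : Fin n) (s t : ℝ), a ≠ b ∧ (s = 1 ∨ s = -1) ∧ (t = 1 ∨ t = -1) ∧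
      x = EuclideanSpace.single a s + EuclideanSpace.single b t := by
  obtain ⟨i, j, hij, h⟩ := hx
  have hneg (k : Fin n) : EuclideanSpace.single k (-1 : ℝ) = -EuclideanSpace.single k (1 : ℝ) := by
    ext l
    by_cases hl : l = k <;> simp [hl]
  rcases h with h | h | h | h
  · exact ⟨i, j, 1, 1, hij.ne, by simp, by simp, h⟩
  · exact ⟨i, j, 1, -1, hij.ne, by simp, by simp, by rw [h, hneg, sub_eq_add_neg]⟩
  · exact ⟨i, j, -1, 1, hij.ne, by simp, by simp, by rw [h, hneg]⟩
  · exact ⟨i, j, -1, -1, hij.ne, by simp, by simp, by rw [h, hneg, hneg, sub_eq_add_neg]⟩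

lemma apply_eq (hx : IsRootDn n x) (a : Fin n) : x a = 0 ∨ x a = 1 ∨ x a = -1 := by
  obtain ⟨i, j, s, t, hij, hs, ht, rfl⟩ := hx.exists_eq_single_add_single
  by_cases hi : a = i
  · subst hi
    simpa [hij] using Or.inr hs
  · by_cases hj : a = j
    · subst hj
      simpa [hi] using Or.inr ht
    · simp [hi, hj]

lemma exists_eq_of_apply_ne_zero (hx : IsRootDn n x) {a : Fin n} (ha : x a ≠ 0) :
    ∃ (c : Fin n) (u : ℝ), a ≠ c ∧ (u = 1 ∨ u = -1) ∧
      x = EuclideanSpace.single a (x a) + EuclideanSpace.single c u := by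
  obtain ⟨i, j, s, t, hij, hs, ht, rfl⟩ := hx.exists_eq_single_add_single
  by_cases hi : a = i
  · subst hi
    exact ⟨j, t, hij, ht, by simp [hij]⟩
  · by_cases hj : a = j
    · subst hj
      exact ⟨i, s, hi, hs, by simp [hi, add_comm]⟩
    · simp [hi, hj] at ha

/-- Orthogonal roots sharing a nonzero coordinate sum to twice a signed basis vector. -/
lemma add_eq_single (hx : IsRootDn n x) (hy : IsRootDn n y) {a : Fin n} (ha : x a ≠ 0)
    (hxy : x a = y a) (h0 : ⟪x, y⟫ = 0) : x + y = EuclideanSpace.single a (2 * x a) := by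
  obtain ⟨c, u, hac, hu, ex⟩ := hx.exists_eq_of_apply_ne_zero ha
  obtain ⟨d, v, had, hv, ey⟩ := hy.exists_eq_of_apply_ne_zero (hxy ▸ ha)
  have hsq : x a * x a = 1 := by
    rcases hx.apply_eq a with h | h | h
    · exact absurd h ha
    · simp [h]
    · simp [h]
  rw [← hxy] at ey
  generalize x a = s at *
  subst ex ey
  rw [inner_add_left, EuclideanSpace.inner_single_left, EuclideanSpace.inner_single_left] at h0
  have hcd : c = d := by
    by_contra hcd
    simp [hac.symm, hcd, had, hsq] at h0
  subst hcd
  have huv : v = -u := by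
    simp [hac.symm, hac, hsq] at h0
    rcases hu with rfl | rfl <;> rcases hv with rfl | rfl <;> linarith
  subst huv
  ext l
  by_cases h1 : l = a
  · subst h1
    simp [hac]
    ring
  · by_cases h2 : l = c <;> simp [h1, h2, hac.symm]

lemma inner_add_inner_even (hx : IsRootDn n x) (hy : IsRootDn n y) (hz : IsRootDn n z)
    {a : Fin n} (ha : x a ≠ 0) (hxy : x a = y a) (h0 : ⟪x, y⟫ = 0) :
    ∃ k : ℤ, ⟪x, z⟫ + ⟪y, z⟫ = 2 * k := by
  rw [← inner_add_left, hx.add_eq_single hy ha hxy h0, EuclideanSpace.inner_single_left]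
  rcases hx.apply_eq a with h | h | h <;> rcases hz.apply_eq a with h' | h' | h' <;> rw [h, h']
  · exact ⟨0, by simp⟩
  · exact ⟨0, by simp⟩
  · exact ⟨0, by simp⟩
  · exact ⟨0, by simp⟩
  · exact ⟨1, by simp⟩
  · exact ⟨-1, by simp⟩
  · exact ⟨0, by simp⟩
  · exact ⟨-1, by simp⟩
  · exact ⟨1, by simp⟩

/-- Among three roots having inner product `-1` with a common root, two share a nonzero
coordinate. -/
lemma exists_apply_eq_apply (hw : IsRootDn n w) (hx : IsRootDn n x) (hy : IsRootDn n y)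
    (hz : IsRootDn n z) (hwx : ⟪w, x⟫ = -1) (hwy : ⟪w, y⟫ = -1) (hwz : ⟪w, z⟫ = -1) :
    ∃ a, (x a ≠ 0 ∧ x a = y a) ∨ (x a ≠ 0 ∧ x a = z a) ∨ (y a ≠ 0 ∧ y a = z a) := by
  obtain ⟨a, b, s, t, -, hs, ht, rfl⟩ := hw.exists_eq_single_add_single
  have key {p : EuclideanSpace ℝ (Fin n)} (hp : IsRootDn n p)
      (h : ⟪EuclideanSpace.single a s + EuclideanSpace.single b t, p⟫ = -1) :
      p a = -s ∨ p b = -t := by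
    rw [inner_add_left, EuclideanSpace.inner_single_left, EuclideanSpace.inner_single_left] at h
    simp only [conj_trivial] at h
    rcases hp.apply_eq a with h1 | h1 | h1 <;> rcases hp.apply_eq b with h2 | h2 | h2 <;>
      rcases hs with rfl | rfl <;> rcases ht with rfl | rfl <;> rw [h1, h2] at h ⊢ <;>
      first | (norm_num; done) | norm_num at h
  have hs0 : -s ≠ 0 := by rcases hs with rfl | rfl <;> norm_num
  have ht0 : -t ≠ 0 := by rcases ht with rfl | rfl <;> norm_num
  rcases key hx hwx with h1 | h1 <;> rcases key hy hwy with h2 | h2 <;>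
    rcases key hz hwz with h3 | h3
  all_goals first
    | exact ⟨a, Or.inl ⟨h1 ▸ hs0, h1.trans h2.symm⟩⟩
    | exact ⟨b, Or.inl ⟨h1 ▸ ht0, h1.trans h2.symm⟩⟩
    | exact ⟨a, Or.inr (Or.inl ⟨h1 ▸ hs0, h1.trans h3.symm⟩)⟩
    | exact ⟨b, Or.inr (Or.inl ⟨h1 ▸ ht0, h1.trans h3.symm⟩)⟩
    | exact ⟨a, Or.inr (Or.inr ⟨h2 ▸ hs0, h2.trans h3.symm⟩)⟩
    | exact ⟨b, Or.inr (Or.inr ⟨h2 ▸ ht0, h2.trans h3.symm⟩)⟩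

end IsRootDn

/-- No root subset of `D_n` realizes the Carter diagram `E₆(a₁)`. -/
theorem E6a1_not_realized_in_Dn (n : ℕ) (hn : 1 ≤ n) :
    ¬ ∃ β : Fin 6 → EuclideanSpace ℝ (Fin n),
      (∀ r, IsRootDn n (β r)) ∧ ∀ r s, ⟪β r, β s⟫ = partialCartanE6a1 r s := by
  rintro ⟨β, hβ, hG⟩
  obtain ⟨a, ⟨ha, h⟩ | ⟨ha, h⟩ | ⟨ha, h⟩⟩ :=
    (hβ 3).exists_apply_eq_apply (hβ 0) (hβ 1) (hβ 2)
      (by simp [hG, partialCartanE6a1]) (by simp [hG, partialCartanE6a1])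
      (by simp [hG, partialCartanE6a1])
  · obtain ⟨k, hk⟩ := (hβ 0).inner_add_inner_even (hβ 1) (hβ 4) ha h
      (by simp [hG, partialCartanE6a1])
    simp [hG, partialCartanE6a1] at hk
    norm_cast at hk
    omega
  · obtain ⟨k, hk⟩ := (hβ 0).inner_add_inner_even (hβ 2) (hβ 5) ha h
      (by simp [hG, partialCartanE6a1])
    simp [hG, partialCartanE6a1] at hk
    norm_cast at hk
    omega
  · obtain ⟨k, hk⟩ := (hβ 1).inner_add_inner_even (hβ 2) (hβ 5) ha h
      (by simp [hG, partialCartanE6a1])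
    simp [hG, partialCartanE6a1] at hk
    norm_cast at hk
    omega
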